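/- arXiv:2501.05279 — 3 statements merged into one kernel-verified Lean document; each statement's English description precedes it below -/
import Mathlib

section
/- Let w = (T + λ Id)^{-1} S*(S w_* + ε). Then ‖Σ^{1/2}(w − w_*)‖_ℋ ≤ ‖(Σ+λId)^{1/2}(T+λId)^{-1}(Σ+λId)^{1/2}‖_{ℋ,ℋ} · ( ‖(Σ+λId)^{-1/2} S* ε‖_ℋ + λ‖(Σ+λId)^{-1/2} w_*‖_ℋ ), and ‖w − w_*‖_ℋ ≤ ‖(Σ+λId)^{1/2}(T+λId)^{-1}(Σ+λId)^{1/2}‖_{ℋ,ℋ} · ( λ^{-1/2} ‖(Σ+λId)^{-1/2} S* ε‖_ℋ + λ^{1/2} ‖(Σ+λId)^{-1/2} w_*‖_ℋ ). -/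
open ContinuousLinearMap

section Helpers
variable {H : Type*} [NormedAddCommGroup H] [InnerProductSpace ℂ H] [CompleteSpace H]

lemma aux_spec (P : H →L[ℂ] H) (hP : P.IsPositive) (lam : ℝ) :
    ∀ x ∈ spectrum ℝ (P + (lam : ℂ) • (1 : H →L[ℂ] H)), lam ≤ x := by
  have h0 : (0 : H →L[ℂ] H) ≤ P := (ContinuousLinearMap.nonneg_iff_isPositive P).2 hP
  have e : P + (lam : ℂ) • (1 : H →L[ℂ] H) = P + algebraMap ℝ (H →L[ℂ] H) lam := by
    rw [Algebra.algebraMap_eq_smul_one]; simp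
  have hs : IsSelfAdjoint (P + algebraMap ℝ (H →L[ℂ] H) lam) :=
    (IsSelfAdjoint.of_nonneg h0).add (IsSelfAdjoint.algebraMap _ (IsSelfAdjoint.all _))
  rw [e]
  exact (algebraMap_le_iff_le_spectrum (ha := hs)).1 (le_add_of_nonneg_left h0)

lemma aux_sa (P : H →L[ℂ] H) (hP : P.IsPositive) (lam : ℝ) :
    IsSelfAdjoint (P + (lam : ℂ) • (1 : H →L[ℂ] H)) := by
  have h0 : (0 : H →L[ℂ] H) ≤ P := (ContinuousLinearMap.nonneg_iff_isPositive P).2 hP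
  refine (IsSelfAdjoint.of_nonneg h0).add ?_
  exact IsSelfAdjoint.smul (by simp [IsSelfAdjoint]) (IsSelfAdjoint.one _)

lemma aux_sqrt (M : H →L[ℂ] H) (hM : IsSelfAdjoint M) (h : ∀ x ∈ spectrum ℝ M, 0 ≤ x) :
    cfc Real.sqrt M * cfc Real.sqrt M = M := by
  rw [← cfc_mul Real.sqrt Real.sqrt M (by fun_prop) (by fun_prop)]
  conv_rhs => rw [← cfc_id ℝ M]
  exact cfc_congr fun x hx => Real.mul_self_sqrt (h x hx)

lemma aux_norm (M : H →L[ℂ] H) (hM : IsSelfAdjoint M) (h : ∀ x ∈ spectrum ℝ M, 0 ≤ x) (v : H) :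
    ‖cfc Real.sqrt M v‖ ^ 2 = (inner ℂ (M v) v).re := by
  have hs : IsSelfAdjoint (cfc Real.sqrt M) := cfc_predicate _ _
  conv_rhs => rw [← aux_sqrt M hM h]
  have := (isSelfAdjoint_iff_isSymmetric.1 hs) (cfc Real.sqrt M v) v
  simp only [ContinuousLinearMap.coe_coe] at this
  rw [ContinuousLinearMap.mul_apply, this]
  exact (inner_self_eq_norm_sq (𝕜 := ℂ) _).symm

lemma aux_inv (M : H →L[ℂ] H) (hM : IsSelfAdjoint M) (h : ∀ x ∈ spectrum ℝ M, 0 < x) :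
    cfc (fun t : ℝ => t⁻¹) M * M = 1 := by
  have hc : ContinuousOn (fun t : ℝ => t⁻¹) (spectrum ℝ M) :=
    continuousOn_id.inv₀ fun x hx => (h x hx).ne'
  nth_rewrite 2 [← cfc_id ℝ M]
  rw [← cfc_mul _ _ M hc (by fun_prop), ← cfc_one ℝ M]
  exact cfc_congr fun x hx => inv_mul_cancel₀ (h x hx).ne'

lemma aux_AB (M : H →L[ℂ] H) (hM : IsSelfAdjoint M) (h : ∀ x ∈ spectrum ℝ M, 0 < x) :
    cfc Real.sqrt M * cfc (fun t : ℝ => t ^ (-(1 : ℝ) / 2)) M = 1 := by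
  have hc : ContinuousOn (fun t : ℝ => t ^ (-(1 : ℝ) / 2)) (spectrum ℝ M) :=
    continuousOn_id.rpow_const fun x hx => Or.inl (h x hx).ne'
  rw [← cfc_mul _ _ M (by fun_prop) hc, ← cfc_one ℝ M]
  refine cfc_congr fun x hx => ?_
  simp only [Real.sqrt_eq_rpow, Pi.one_apply]
  rw [← Real.rpow_add (h x hx)]
  norm_num

end Helpers


/-- Error decomposition for ridge regression.  `ℋ, 𝒦` are complex Hilbert
spaces, `S : ℋ → 𝒦` bounded with adjoint `S*`, `T = S*S`, `Sig` a bounded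
positive self-adjoint operator on `ℋ`, `λ > 0`, `w_* ∈ ℋ`, `ε ∈ 𝒦`; fractional
powers and inverses are given by the continuous functional calculus.
With `w = (T + λ Id)⁻¹ S*(S w_* + ε)` one has
`‖Sig^{1/2}(w − w_*)‖ ≤ ‖(Sig+λ)^{1/2}(T+λ)⁻¹(Sig+λ)^{1/2}‖ ·
  (‖(Sig+λ)^{-1/2} S* ε‖ + λ ‖(Sig+λ)^{-1/2} w_*‖)` and
`‖w − w_*‖ ≤ ‖(Sig+λ)^{1/2}(T+λ)⁻¹(Sig+λ)^{1/2}‖ ·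
  (λ^{-1/2} ‖(Sig+λ)^{-1/2} S* ε‖ + λ^{1/2} ‖(Sig+λ)^{-1/2} w_*‖)`. -/
theorem ridge_error_decomposition
    {H K : Type*} [NormedAddCommGroup H] [InnerProductSpace ℂ H] [CompleteSpace H]
    [NormedAddCommGroup K] [InnerProductSpace ℂ K] [CompleteSpace K]
    (S : H →L[ℂ] K) (Sig : H →L[ℂ] H) (hSig : Sig.IsPositive)
    (lam : ℝ) (hlam : 0 < lam) (wstar : H) (eps : K) :
    let T : H →L[ℂ] H := (adjoint S).comp S
    let Tinv : H →L[ℂ] H := cfc (fun t : ℝ => t⁻¹) (T + (lam : ℂ) • 1)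
    let A : H →L[ℂ] H := cfc Real.sqrt (Sig + (lam : ℂ) • 1)
    let B : H →L[ℂ] H := cfc (fun t : ℝ => t ^ (-(1 : ℝ) / 2)) (Sig + (lam : ℂ) • 1)
    let w : H := Tinv (adjoint S (S wstar + eps))
    ‖cfc Real.sqrt Sig (w - wstar)‖ ≤
        ‖(A.comp Tinv).comp A‖ * (‖B (adjoint S eps)‖ + lam * ‖B wstar‖) ∧
    ‖w - wstar‖ ≤
        ‖(A.comp Tinv).comp A‖ *
          ((Real.sqrt lam)⁻¹ * ‖B (adjoint S eps)‖ + Real.sqrt lam * ‖B wstar‖) := by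
  intro T Tinv A B w
  have hT : T.IsPositive := ContinuousLinearMap.isPositive_adjoint_comp_self S
  have hTi : Tinv * (T + (lam : ℂ) • 1) = 1 :=
    aux_inv _ (aux_sa T hT lam) fun x hx => hlam.trans_le (aux_spec T hT lam x hx)
  have hpos : ∀ x ∈ spectrum ℝ (Sig + (lam : ℂ) • (1 : H →L[ℂ] H)), 0 < x :=
    fun x hx => hlam.trans_le (aux_spec Sig hSig lam x hx)
  have hAB : A * B = 1 := aux_AB _ (aux_sa Sig hSig lam) hpos
  have hA : ∀ v, ‖A v‖ ^ 2 = ‖cfc Real.sqrt Sig v‖ ^ 2 + lam * ‖v‖ ^ 2 := by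
    intro v
    have h1 := aux_norm _ (aux_sa Sig hSig lam) (fun x hx => (hpos x hx).le) v
    have h2 := aux_norm Sig hSig.isSelfAdjoint
      (fun x hx => spectrum_nonneg_of_nonneg
        ((ContinuousLinearMap.nonneg_iff_isPositive Sig).2 hSig) hx) v
    have h3 : (inner ℂ v v).re = ‖v‖ ^ 2 := inner_self_eq_norm_sq (𝕜 := ℂ) v
    change ‖A v‖ ^ 2 = _ at h1
    rw [h1, h2, ContinuousLinearMap.add_apply, inner_add_left, Complex.add_re,
      ContinuousLinearMap.smul_apply, ContinuousLinearMap.one_apply, inner_smul_left,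
      Complex.conj_ofReal, Complex.re_ofReal_mul, h3]
  have hABv : ∀ v, A (B v) = v := fun v => by
    rw [← ContinuousLinearMap.mul_apply, hAB, ContinuousLinearMap.one_apply]
  have hw : w - wstar = Tinv (adjoint S eps - (lam : ℂ) • wstar) := by
    have h1 : wstar = Tinv (T wstar + (lam : ℂ) • wstar) := by
      have := congrArg (fun L : H →L[ℂ] H => L wstar) hTi
      simpa using this.symm
    have h2 : T wstar = adjoint S (S wstar) := rfl
    have h3 : w - wstar = w - Tinv (T wstar + (lam : ℂ) • wstar) := by rw [← h1]
    rw [h3, ← map_sub]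
    congr 1
    rw [h2, map_add]
    abel
  have key : ‖A (w - wstar)‖ ≤
      ‖(A.comp Tinv).comp A‖ * (‖B (adjoint S eps)‖ + lam * ‖B wstar‖) := by
    have e : A (w - wstar) =
        ((A.comp Tinv).comp A) (B (adjoint S eps) - (lam : ℂ) • B wstar) := by
      rw [hw, ← map_smul, ← map_sub]
      simp only [ContinuousLinearMap.comp_apply, hABv]
    rw [e]
    refine (le_opNorm _ _).trans ?_
    gcongr
    refine (norm_sub_le _ _).trans ?_
    rw [norm_smul, Complex.norm_real, Real.norm_of_nonneg hlam.le]
  refine ⟨le_trans ?_ key, ?_⟩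
  · refine (sq_le_sq₀ (by positivity) (norm_nonneg _)).1 ?_
    rw [hA]
    have : 0 ≤ lam * ‖w - wstar‖ ^ 2 := by positivity
    linarith
  · have hs : 0 < Real.sqrt lam := Real.sqrt_pos.2 hlam
    have hss : Real.sqrt lam ^ 2 = lam := Real.sq_sqrt hlam.le
    have h1 : Real.sqrt lam * ‖w - wstar‖ ≤ ‖A (w - wstar)‖ := by
      refine (sq_le_sq₀ (by positivity) (norm_nonneg _)).1 ?_
      rw [hA, mul_pow, hss]
      have : 0 ≤ ‖cfc Real.sqrt Sig (w - wstar)‖ ^ 2 := by positivity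
      linarith
    refine le_of_mul_le_mul_left ((h1.trans key).trans (le_of_eq ?_)) hs
    have h4 : Real.sqrt lam * (Real.sqrt lam)⁻¹ = 1 := mul_inv_cancel₀ hs.ne'
    generalize ‖(A.comp Tinv).comp A‖ = N
    generalize ‖B (adjoint S eps)‖ = p
    generalize ‖B wstar‖ = q
    linear_combination (-(N * p)) * h4 - N * q * hss
end

section
/- Let Δ = (Σ+λId)^{-1/2}(Σ − T)(Σ+λId)^{-1/2} and let t_sup = sup{ t : t ∈ σ(Δ) } be the supremum of the spectrum of the self-adjoint operator Δ. If t_sup ≤ 1/2, then ‖(Σ+λId)^{1/2}(T+λId)^{-1/2}‖²_{ℋ,ℋ} = ‖(Σ+λId)^{1/2}(T+λId)^{-1}(Σ+λId)^{1/2}‖_{ℋ,ℋ} ≤ 2. -/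
open ContinuousLinearMap

open ContinuousLinearMap in
lemma shift_nonneg {H : Type*} [NormedAddCommGroup H] [InnerProductSpace ℂ H] [CompleteSpace H]
    (S : H →L[ℂ] H) (hS : S.IsPositive) (lam : ℝ) (hlam : 0 < lam) :
    IsSelfAdjoint (S + (lam : ℂ) • 1) ∧ ∀ t ∈ spectrum ℝ (S + (lam : ℂ) • 1), 0 < t := by
  have h0 : 0 ≤ S := (nonneg_iff_isPositive S).2 hS
  have e : S + (lam : ℂ) • 1 = S + algebraMap ℝ (H →L[ℂ] H) lam := by
    ext x; simp [Algebra.algebraMap_eq_smul_one]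
  have hsa : IsSelfAdjoint (S + (lam : ℂ) • 1) := by
    rw [e]; exact (IsSelfAdjoint.of_nonneg h0).add (IsSelfAdjoint.algebraMap _ (.all lam))
  refine ⟨hsa, fun t ht => ?_⟩
  have : algebraMap ℝ (H →L[ℂ] H) lam ≤ S + (lam : ℂ) • 1 := by
    rw [e]; exact le_add_of_nonneg_left h0
  exact hlam.trans_le ((algebraMap_le_iff_le_spectrum (a := S + (lam : ℂ) • 1) hsa).1 this t ht)


/-- `Sig` and `T` are bounded positive self-adjoint operators on a complex
Hilbert space `ℋ`, `λ > 0`; powers are taken via the continuous functional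
calculus.  Let `Δ = (Sig+λ)^{-1/2}(Sig − T)(Sig+λ)^{-1/2}` and let `t_sup` be
the supremum of the (real) spectrum of the self-adjoint operator `Δ`.  If
`t_sup ≤ 1/2`, then
`‖(Sig+λ)^{1/2}(T+λ)^{-1/2}‖² = ‖(Sig+λ)^{1/2}(T+λ)⁻¹(Sig+λ)^{1/2}‖ ≤ 2`. -/
theorem less_is_more
    {H : Type*} [NormedAddCommGroup H] [InnerProductSpace ℂ H] [CompleteSpace H]
    (Sig T : H →L[ℂ] H) (hSig : Sig.IsPositive) (hT : T.IsPositive)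
    (lam : ℝ) (hlam : 0 < lam) :
    let A : H →L[ℂ] H := cfc Real.sqrt (Sig + (lam : ℂ) • 1)
    let B : H →L[ℂ] H := cfc (fun t : ℝ => t ^ (-(1 : ℝ) / 2)) (Sig + (lam : ℂ) • 1)
    let Tinv : H →L[ℂ] H := cfc (fun t : ℝ => t⁻¹) (T + (lam : ℂ) • 1)
    let Tinvhalf : H →L[ℂ] H := cfc (fun t : ℝ => t ^ (-(1 : ℝ) / 2)) (T + (lam : ℂ) • 1)
    let Delta : H →L[ℂ] H := (B.comp (Sig - T)).comp B
    sSup {t : ℝ | (t : ℂ) ∈ spectrum ℂ Delta} ≤ 1 / 2 →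
      ‖A.comp Tinvhalf‖ ^ 2 = ‖(A.comp Tinv).comp A‖ ∧
      ‖(A.comp Tinv).comp A‖ ≤ 2 := by
  intro A B Tinv C Delta hD
  obtain ⟨hS, hSp⟩ := shift_nonneg Sig hSig lam hlam
  obtain ⟨hR, hRp⟩ := shift_nonneg T hT lam hlam
  set S : H →L[ℂ] H := Sig + (lam : ℂ) • 1 with hSdef
  set R : H →L[ℂ] H := T + (lam : ℂ) • 1 with hRdef
  have hA : IsSelfAdjoint A := cfc_predicate _ _
  have hB : IsSelfAdjoint B := cfc_predicate _ _
  have hC : IsSelfAdjoint C := cfc_predicate _ _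
  have cS : ContinuousOn (fun t : ℝ => t ^ (-(1 : ℝ) / 2)) (spectrum ℝ S) :=
    fun t ht => (Real.continuousAt_rpow_const _ _ (Or.inl (hSp t ht).ne')).continuousWithinAt
  have cR : ContinuousOn (fun t : ℝ => t ^ (-(1 : ℝ) / 2)) (spectrum ℝ R) :=
    fun t ht => (Real.continuousAt_rpow_const _ _ (Or.inl (hRp t ht).ne')).continuousWithinAt
  have cq : ContinuousOn Real.sqrt (spectrum ℝ S) := Real.continuous_sqrt.continuousOn
  have half : ∀ t : ℝ, 0 < t → t ^ (-(1 : ℝ) / 2) * t ^ (-(1 : ℝ) / 2) = t⁻¹ := by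
    intro t ht
    rw [← Real.rpow_add ht, ← Real.rpow_neg_one]; norm_num
  have sq : ∀ t : ℝ, 0 < t → Real.sqrt t * t ^ (-(1 : ℝ) / 2) = 1 := by
    intro t ht
    rw [Real.sqrt_eq_rpow, ← Real.rpow_add ht]; norm_num
  have hAA : A * A = S := by
    rw [← cfc_mul Real.sqrt Real.sqrt S cq cq]
    conv_rhs => rw [← cfc_id' ℝ S]
    exact cfc_congr fun t ht => Real.mul_self_sqrt (hSp t ht).le
  have hAB : A * B = 1 := by
    rw [← cfc_mul _ _ S cq cS, ← cfc_one ℝ S]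
    exact cfc_congr fun t ht => sq t (hSp t ht)
  have hBA : B * A = 1 := by
    rw [← cfc_mul _ _ S cS cq, ← cfc_one ℝ S]
    exact cfc_congr fun t ht => by simpa [mul_comm] using sq t (hSp t ht)
  have hCC : C * C = Tinv := by
    rw [← cfc_mul _ _ R cR cR]
    exact cfc_congr fun t ht => half t (hRp t ht)
  have hCRC : C * R * C = 1 := by
    have : R = cfc (fun t : ℝ => t) R := (cfc_id' ℝ R).symm
    have cid : ContinuousOn (fun t : ℝ => t) (spectrum ℝ R) := continuousOn_id
    have cm : ContinuousOn (fun t : ℝ => t ^ (-(1 : ℝ) / 2) * t) (spectrum ℝ R) := cR.mul cid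
    rw [this]
    change cfc (fun t : ℝ => t ^ (-(1 : ℝ) / 2)) R * cfc (fun t : ℝ => t) R
      * cfc (fun t : ℝ => t ^ (-(1 : ℝ) / 2)) R = 1
    rw [← cfc_mul _ _ R cR cid, ← cfc_mul _ _ R cm cR,
      ← cfc_one ℝ R]
    refine cfc_congr fun t ht => ?_
    have h := half t (hRp t ht)
    have := (hRp t ht).ne'
    simp only [Pi.one_apply]
    calc _ = (t ^ (-(1 : ℝ) / 2) * t ^ (-(1 : ℝ) / 2)) * t := by ring
      _ = 1 := by rw [h]; field_simp
  have hDe : Delta = B * (S - R) * B := by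
    have : S - R = Sig - T := by simp [hSdef, hRdef]
    rw [this]; rfl
  have hDsa : IsSelfAdjoint Delta := by
    rw [hDe]
    simpa [hB.star_eq] using (hS.sub hR).conjugate B
  have hset : {t : ℝ | (t : ℂ) ∈ spectrum ℂ Delta} = spectrum ℝ Delta := by
    rw [← spectrum.preimage_algebraMap (R := ℝ) ℂ]; rfl
  have hDle : Delta ≤ algebraMap ℝ (H →L[ℂ] H) (1 / 2) := by
    rw [le_algebraMap_iff_spectrum_le hDsa]
    intro t ht
    rw [hset] at hD
    exact (le_csSup (spectrum.isCompact Delta).bddAbove ht).trans hD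
  have h1 : S - R ≤ (1 / 2 : ℝ) • S := by
    have := hA.conjugate_le_conjugate hDle
    have e1 : A * Delta * A = S - R := by
      rw [hDe]
      calc _ = (A * B) * (S - R) * (B * A) := by noncomm_ring
        _ = _ := by rw [hAB, hBA]; simp
    rwa [e1, Algebra.algebraMap_eq_smul_one, mul_smul_comm, smul_mul_assoc, mul_one, hAA] at this
  have h2 : S ≤ (2 : ℝ) • R := by
    have h3 : (2 : ℝ) • (S - R) ≤ (2 : ℝ) • ((1 / 2 : ℝ) • S) :=
      smul_le_smul_of_nonneg_left h1 (by norm_num)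
    rw [smul_smul] at h3
    norm_num at h3
    rw [smul_sub, two_smul ℝ S] at h3
    rw [← sub_nonneg] at h3 ⊢
    convert h3 using 1
    abel
  have h4 : C * S * C ≤ algebraMap ℝ (H →L[ℂ] H) 2 := by
    have := hC.conjugate_le_conjugate h2
    rwa [mul_smul_comm, smul_mul_assoc, hCRC, ← Algebra.algebraMap_eq_smul_one] at this
  have e2 : star (A * C) * (A * C) = C * S * C := by
    rw [star_mul, hA.star_eq, hC.star_eq, ← hAA]; noncomm_ring
  have e3 : (A * C) * star (A * C) = A * Tinv * A := by
    rw [star_mul, hA.star_eq, hC.star_eq, ← hCC]; noncomm_ring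
  have n1 : ‖A * C‖ ^ 2 = ‖A * Tinv * A‖ := by
    rw [← e3, CStarRing.norm_self_mul_star, pow_two]
  have n2 : ‖A * C‖ ^ 2 ≤ 2 := by
    rw [pow_two, ← CStarRing.norm_star_mul_self, e2]
    have h0 : 0 ≤ C * S * C := e2 ▸ star_mul_self_nonneg _
    exact (CStarAlgebra.norm_le_iff_le_algebraMap _ (by norm_num) h0).2 h4
  exact ⟨n1, n1 ▸ n2⟩
end

section
/- Let b > 1, C > 0 and λ > 0, and let (σ_ℓ)_{ℓ≥1} be a sequence of nonnegative reals with σ_ℓ ≤ C ℓ^{−b} for all ℓ ≥ 1. Then ∑_{ℓ=1}^∞ σ_ℓ/(σ_ℓ + λ) ≤ (C/λ)^{1/b} ∫₀^∞ (1 + x^b)^{-1} dx, the integral being finite since b > 1. -/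
open MeasureTheory

/-- Let `b > 1`, `C > 0`, `λ > 0`, and let `(σ_ℓ)_{ℓ ≥ 1}` be a sequence of
nonnegative reals with `σ_ℓ ≤ C ℓ^{-b}`.  Then
`∑_{ℓ=1}^∞ σ_ℓ/(σ_ℓ + λ) ≤ (C/λ)^{1/b} ∫₀^∞ (1 + x^b)⁻¹ dx`, the integral
being finite since `b > 1`. -/
theorem effective_dimension_bound (b C lam : ℝ) (hb : 1 < b) (hC : 0 < C) (hlam : 0 < lam)
    (σ : ℕ → ℝ) (hσ0 : ∀ ℓ : ℕ, 1 ≤ ℓ → 0 ≤ σ ℓ)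
    (hσ : ∀ ℓ : ℕ, 1 ≤ ℓ → σ ℓ ≤ C * (ℓ : ℝ) ^ (-b)) :
    IntegrableOn (fun x : ℝ => (1 + x ^ b)⁻¹) (Set.Ioi (0 : ℝ)) ∧
    ∑' ℓ : ℕ, σ (ℓ + 1) / (σ (ℓ + 1) + lam) ≤
      (C / lam) ^ (1 / b) * ∫ x in Set.Ioi (0 : ℝ), (1 + x ^ b)⁻¹ := by
  have hb0 : 0 < b := by linarith
  have hmeas : Measurable (fun x : ℝ => (1 + x ^ b)⁻¹) := by fun_prop
  have hint : IntegrableOn (fun x : ℝ => (1 + x ^ b)⁻¹) (Set.Ioi (0 : ℝ)) := by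
    rw [← Set.Ioc_union_Ioi_eq_Ioi (zero_le_one' ℝ)]
    refine IntegrableOn.union ?_ ?_
    · refine Measure.integrableOn_of_bounded (M := 1) (by simp) hmeas.aestronglyMeasurable ?_
      refine (ae_restrict_iff' measurableSet_Ioc).2 (Filter.Eventually.of_forall fun x hx => ?_)
      have h : 0 ≤ x ^ b := Real.rpow_nonneg hx.1.le b
      rw [Real.norm_of_nonneg (by positivity)]
      exact inv_le_one_of_one_le₀ (by linarith)
    · refine Integrable.mono' (integrableOn_Ioi_rpow_of_lt (a := -b) (by linarith) one_pos)
        hmeas.aestronglyMeasurable ?_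
      refine (ae_restrict_iff' measurableSet_Ioi).2 (Filter.Eventually.of_forall fun x hx => ?_)
      have hx0 : (0 : ℝ) < x := lt_trans one_pos hx
      have h : 0 < x ^ b := Real.rpow_pos_of_pos hx0 b
      rw [Real.norm_of_nonneg (by positivity), Real.rpow_neg hx0.le]
      exact inv_anti₀ h (by linarith)
  refine ⟨hint, ?_⟩
  obtain ⟨a, ha⟩ : ∃ a, a = (C / lam) ^ (1 / b) := ⟨_, rfl⟩
  have hapos : 0 < a := by rw [ha]; positivity
  have hab : a ^ b = C / lam := by
    rw [ha, ← Real.rpow_mul (by positivity), one_div_mul_cancel hb0.ne', Real.rpow_one]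
  rw [← ha]
  have hscale := integral_comp_mul_left_Ioi (fun x : ℝ => (1 + x ^ b)⁻¹) 0 (inv_pos.2 hapos)
  have hsint := (integrableOn_Ioi_comp_mul_left_iff (fun x : ℝ => (1 + x ^ b)⁻¹) 0
    (inv_pos.2 hapos)).2 (by simpa using hint)
  simp only [mul_zero, inv_inv, smul_eq_mul] at hscale
  rw [← hscale]
  refine Real.tsum_le_of_sum_range_le (fun n => ?_) (fun n => ?_)
  · have := hσ0 (n + 1) (by omega)
    positivity
  have hterm : ∀ i : ℕ, σ (i + 1) / (σ (i + 1) + lam) ≤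
      (1 + (a⁻¹ * (0 + ((i + 1 : ℕ) : ℝ))) ^ b)⁻¹ := by
    intro i
    have h0 := hσ0 (i + 1) (by omega)
    have h1 := hσ (i + 1) (by omega)
    have hi : (0 : ℝ) < ((i + 1 : ℕ) : ℝ) := by positivity
    rw [zero_add, Real.mul_rpow (by positivity) hi.le, Real.inv_rpow hapos.le, hab]
    rw [Real.rpow_neg hi.le] at h1
    have hp : 0 < ((i + 1 : ℕ) : ℝ) ^ b := Real.rpow_pos_of_pos hi b
    generalize ((i + 1 : ℕ) : ℝ) ^ b = p at *
    generalize σ (i + 1) = s at *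
    have h2 : s * p ≤ C := by
      rw [← div_eq_mul_inv, le_div_iff₀ hp] at h1
      exact h1
    have h3 : (1 + (C / lam)⁻¹ * p)⁻¹ = C / (C + lam * p) := by
      field_simp
    rw [h3, div_le_div_iff₀ (by positivity) (by positivity)]
    nlinarith
  have hnn : ∀ x ∈ Set.Ioi (0 : ℝ), 0 ≤ (1 + (a⁻¹ * x) ^ b)⁻¹ := by
    intro x hx
    have hx : 0 < x := hx
    positivity
  have hanti : AntitoneOn (fun x : ℝ => (1 + (a⁻¹ * x) ^ b)⁻¹) (Set.Icc (0 : ℝ) (0 + (n : ℝ))) := by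
    intro x hx y hy hxy
    have hx0 : 0 ≤ x := hx.1
    have : 0 ≤ a⁻¹ * x := by positivity
    dsimp only
    gcongr
  calc _ ≤ ∑ i ∈ Finset.range n, (1 + (a⁻¹ * (0 + ((i + 1 : ℕ) : ℝ))) ^ b)⁻¹ :=
        Finset.sum_le_sum fun i _ => hterm i
    _ ≤ ∫ x in (0 : ℝ)..(0 + (n : ℝ)), (1 + (a⁻¹ * x) ^ b)⁻¹ := hanti.sum_le_integral
    _ ≤ _ := by
        rw [intervalIntegral.integral_of_le (by simp)]
        refine setIntegral_mono_set hsint ?_ (Set.Ioc_subset_Ioi_self.eventuallyLE)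
        exact (ae_restrict_iff' measurableSet_Ioi).2 (Filter.Eventually.of_forall hnn)
end
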